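/- arXiv:1401.2225 — 4 statements merged into one kernel-verified Lean document; each statement's English description precedes it below -/
import Mathlib

section
/- (Cartan decomposition, existence.) For every g ∈ GL_n(𝒦) there exist a dominant λ ∈ ℤⁿ and elements k₁, k₂ ∈ K such that g = k₁ · t^λ · k₂. -/
open scoped Pointwise

set_option synthInstance.maxHeartbeats 1000000
set_option maxHeartbeats 1000000

noncomputable section

abbrev Kfld : Type := LaurentSeries ℂ

def Oring : Subring Kfld := (HahnSeries.ofPowerSeries ℤ ℂ).range

def tK : Kfld := HahnSeries.single (1 : ℤ) 1

lemma tK_ne_zero : tK ≠ 0 := HahnSeries.single_ne_zero one_ne_zero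

abbrev GLn (n : ℕ) := Matrix.GeneralLinearGroup (Fin n) Kfld

def KSub (n : ℕ) : Subgroup (GLn n) where
  carrier := {g | (∀ i j, (g : Matrix (Fin n) (Fin n) Kfld) i j ∈ Oring) ∧
      (∀ i j, ((g⁻¹ : GLn n) : Matrix (Fin n) (Fin n) Kfld) i j ∈ Oring)}
  one_mem' := by
    refine ⟨fun i j => ?_, fun i j => ?_⟩ <;>
      simp only [inv_one, Units.val_one, Matrix.one_apply] <;>
      split <;> first | exact one_mem _ | exact zero_mem _
  mul_mem' := by
    rintro a b ⟨ha1, ha2⟩ ⟨hb1, hb2⟩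
    refine ⟨fun i j => ?_, fun i j => ?_⟩
    · rw [Units.val_mul, Matrix.mul_apply]
      exact Subring.sum_mem _ fun k _ => mul_mem (ha1 i k) (hb1 k j)
    · rw [mul_inv_rev, Units.val_mul, Matrix.mul_apply]
      exact Subring.sum_mem _ fun k _ => mul_mem (hb2 i k) (ha2 k j)
  inv_mem' := by
    rintro a ⟨h1, h2⟩
    exact ⟨h2, by simpa using h1⟩

lemma mem_KSub {n : ℕ} (g : GLn n) :
    g ∈ KSub n ↔ (∀ i j, (g : Matrix (Fin n) (Fin n) Kfld) i j ∈ Oring) ∧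
      (∀ i j, ((g⁻¹ : GLn n) : Matrix (Fin n) (Fin n) Kfld) i j ∈ Oring) := Iff.rfl

abbrev Gr (n : ℕ) := GLn n ⧸ KSub n

def Dominant {n : ℕ} (lam : Fin n → ℤ) : Prop := ∀ i j : Fin n, i ≤ j → lam j ≤ lam i

def tPow (n : ℕ) (lam : Fin n → ℤ) : GLn n where
  val := Matrix.diagonal fun i => tK ^ lam i
  inv := Matrix.diagonal fun i => tK ^ (-lam i)
  val_inv := by
    have h : (fun i => tK ^ lam i * tK ^ (-lam i)) = fun _ : Fin n => (1 : Kfld) := by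
      funext i; rw [← zpow_add₀ tK_ne_zero]; simp
    rw [Matrix.diagonal_mul_diagonal, h, Matrix.diagonal_one]
  inv_val := by
    have h : (fun i => tK ^ (-lam i) * tK ^ lam i) = fun _ : Fin n => (1 : Kfld) := by
      funext i; rw [← zpow_add₀ tK_ne_zero]; simp
    rw [Matrix.diagonal_mul_diagonal, h, Matrix.diagonal_one]

def lamStar {n : ℕ} (lam : Fin n → ℤ) : Fin n → ℤ := fun i => -lam i.rev

def dcoset (n : ℕ) (lam : Fin n → ℤ) : Set (GLn n) :=
  {g | ∃ k₁ ∈ KSub n, ∃ k₂ ∈ KSub n, g = k₁ * tPow n lam * k₂}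

/-- A pair of bases adapted to a full-rank submodule of a free module over a discrete valuation
ring, in which the elementary divisors are weakly decreasing powers of a uniformizer. -/
lemma exists_adapted_bases_antitone {R : Type*} [CommRing R] [IsDomain R]
    [IsDiscreteValuationRing R] {ϖ : R} (hϖ : Irreducible ϖ) {M : Type*} [AddCommGroup M]
    [Module R M] {n : ℕ} (b : Module.Basis (Fin n) R M) (N : Submodule R M)
    (h : Module.finrank R N = Module.finrank R M) :
    ∃ (b' : Module.Basis (Fin n) R M) (k : Fin n → ℕ) (c : Module.Basis (Fin n) R N),
      Antitone k ∧ ∀ i, (c i : M) = ϖ ^ k i • b' i := by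
  obtain ⟨b', a, c, hc⟩ := Submodule.exists_smith_normal_form_of_rank_eq b h
  have ha : ∀ i, a i ≠ 0 := fun i hi => c.ne_zero i (by
    rw [← Submodule.coe_eq_zero, hc, hi, zero_smul])
  choose k u hk using fun i =>
    IsDiscreteValuationRing.eq_unit_mul_pow_irreducible (ha i) hϖ
  let σ := Tuple.sort (OrderDual.toDual ∘ k)
  refine ⟨(b'.unitsSMul u).reindex σ.symm, k ∘ σ, c.reindex σ.symm,
    fun i j hij => Tuple.monotone_sort (OrderDual.toDual ∘ k) hij, fun i => ?_⟩
  simp only [Module.Basis.reindex_apply, Equiv.symm_symm, hc, hk, Module.Basis.unitsSMul_apply,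
    Function.comp_apply, Units.smul_def, smul_smul]
  rw [mul_comm]

/-- Smith normal form of a square matrix with nonzero determinant over a discrete valuation
ring. -/
lemma exists_eq_mul_diagonal_pow_mul {R : Type*} [CommRing R] [IsDomain R]
    [IsDiscreteValuationRing R] {ϖ : R} (hϖ : Irreducible ϖ) {n : ℕ}
    (A : Matrix (Fin n) (Fin n) R) (hA : A.det ≠ 0) :
    ∃ (k : Fin n → ℕ) (P Q : Matrix.GeneralLinearGroup (Fin n) R), Antitone k ∧
      A = (P : Matrix (Fin n) (Fin n) R) * Matrix.diagonal (fun i => ϖ ^ k i) * Q := by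
  let e := LinearEquiv.ofInjective (Matrix.toLin' A)
    (show Function.Injective (Matrix.toLin' A) from Matrix.mulVec_injective_of_det_ne_zero hA)
  let s := Pi.basisFun R (Fin n)
  obtain ⟨b, k, c, hk, hc⟩ := exists_adapted_bases_antitone hϖ s (LinearMap.range (Matrix.toLin' A))
    e.finrank_eq.symm
  let d := s.map e
  refine ⟨k, ⟨s.toMatrix b, b.toMatrix s, s.toMatrix_mul_toMatrix_flip b,
    b.toMatrix_mul_toMatrix_flip s⟩, ⟨c.toMatrix d, d.toMatrix c, c.toMatrix_mul_toMatrix_flip d,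
    d.toMatrix_mul_toMatrix_flip c⟩, hk, ?_⟩
  ext i j
  have hd : (d j : Fin n → R) i = A i j := by
    simp only [d, s, e, Module.Basis.map_apply, Pi.basisFun_apply, LinearEquiv.ofInjective_apply]
    simp
  rw [← hd, ← c.sum_toMatrix_smul_self d j]
  simp only [Submodule.coe_sum, Submodule.coe_smul, hc, Finset.sum_apply, Pi.smul_apply,
    smul_eq_mul, Matrix.mul_apply (M := _ * _), Matrix.mul_diagonal, Module.Basis.toMatrix_apply, s,
    Pi.basisFun_repr]
  exact Finset.sum_congr rfl fun l _ => by ring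

lemma map_ofPowerSeries_mem_KSub {n : ℕ} (P : Matrix.GeneralLinearGroup (Fin n) (PowerSeries ℂ)) :
    Matrix.GeneralLinearGroup.map (HahnSeries.ofPowerSeries ℤ ℂ) P ∈ KSub n := by
  refine ⟨fun i j => ⟨P.val i j, rfl⟩, fun i j => ?_⟩
  rw [← map_inv]
  exact ⟨(P⁻¹).val i j, rfl⟩

lemma exists_pow_smul_eq_map_ofPowerSeries {m n : Type*} [Finite m] [Finite n]
    (g : Matrix m n Kfld) :
    ∃ (d : ℕ) (A : Matrix m n (PowerSeries ℂ)),
      A.map (HahnSeries.ofPowerSeries ℤ ℂ) = tK ^ d • g := by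
  obtain ⟨⟨_, d, rfl⟩, hd⟩ := IsLocalization.exist_integer_multiples_of_finite
    (Submonoid.powers (PowerSeries.X : PowerSeries ℂ)) fun p : m × n => g p.1 p.2
  choose A hA using hd
  refine ⟨d, Matrix.of fun i j => A (i, j), ?_⟩
  ext1 i j
  simpa [Algebra.smul_def, tK] using hA (i, j)


theorem statement1 (n : ℕ) (g : GLn n) :
    ∃ lam : Fin n → ℤ, Dominant lam ∧ ∃ k₁ ∈ KSub n, ∃ k₂ ∈ KSub n,
      g = k₁ * tPow n lam * k₂ := by
  obtain ⟨d, A, hA⟩ := exists_pow_smul_eq_map_ofPowerSeries g.val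
  have htd : tK ^ d ≠ 0 := pow_ne_zero _ tK_ne_zero
  have hdet : A.det ≠ 0 := fun h0 => by
    have h := (HahnSeries.ofPowerSeries ℤ ℂ).map_det A
    rw [h0, map_zero, RingHom.mapMatrix_apply, hA, Matrix.det_smul] at h
    exact mul_ne_zero (pow_ne_zero _ htd) ((Matrix.isUnit_iff_isUnit_det _).mp g.isUnit).ne_zero
      h.symm
  obtain ⟨k, P, Q, hk, hPQ⟩ := exists_eq_mul_diagonal_pow_mul PowerSeries.X_irreducible A hdet
  refine ⟨fun i => k i - d, fun i j hij => sub_le_sub_right (Int.ofNat_le.mpr (hk hij)) _,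
    _, map_ofPowerSeries_mem_KSub P, _, map_ofPowerSeries_mem_KSub Q, Units.ext ?_⟩
  have ht : HahnSeries.ofPowerSeries ℤ ℂ PowerSeries.X = tK := HahnSeries.ofPowerSeries_X
  have hdiag : (Matrix.diagonal fun i => (PowerSeries.X : PowerSeries ℂ) ^ k i).map
      (HahnSeries.ofPowerSeries ℤ ℂ) = tK ^ d • (tPow n fun i => k i - d).val := by
    rw [Matrix.diagonal_map (map_zero _)]
    refine Eq.trans (congrArg _ ?_) (Matrix.diagonal_smul _ _)
    funext i
    change HahnSeries.ofPowerSeries ℤ ℂ (PowerSeries.X ^ k i) = tK ^ d * tK ^ ((k i : ℤ) - d)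
    rw [map_pow, ht, zpow_sub₀ tK_ne_zero,
      zpow_natCast, zpow_natCast, mul_div_cancel₀ _ htd]
  apply smul_right_injective _ htd
  change tK ^ d • g.val = tK ^ d • (P.val.map (HahnSeries.ofPowerSeries ℤ ℂ) *
    (tPow n fun i => k i - d).val * Q.val.map (HahnSeries.ofPowerSeries ℤ ℂ))
  rw [← hA, hPQ, Matrix.map_mul, Matrix.map_mul, hdiag]
  exact (congrArg (· * _) (Matrix.mul_smul _ (tK ^ d) _)).trans (Matrix.smul_mul (tK ^ d) _ _)

end
end

section
/- (Cartan decomposition, uniqueness.) If λ, μ ∈ ℤⁿ are both dominant and K t^λ K ∩ K t^μ K ≠ ∅ (equivalently, k₁ t^λ k₂ = k₁′ t^μ k₂′ for some k₁,k₂,k₁′,k₂′ ∈ K), then λ = μ. -/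
open scoped Pointwise

set_option synthInstance.maxHeartbeats 1000000
set_option maxHeartbeats 1000000

noncomputable section

/-- A square matrix vanishing on the block of rows `≤ m` and columns `≥ m` is singular. -/
lemma det_eq_zero_of_corner_eq_zero {R ι : Type*} [CommRing R] [Fintype ι] [LinearOrder ι]
    [LocallyFiniteOrderTop ι] (M : Matrix ι ι R) (m : ι)
    (h : ∀ i j, i ≤ m → m ≤ j → M i j = 0) : M.det = 0 := by
  rw [Matrix.det_apply]
  refine Finset.sum_eq_zero fun σ _ => ?_
  obtain ⟨j, hj, hσ⟩ : ∃ j, m ≤ j ∧ σ j ≤ m := by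
    by_contra! hcon
    have hle : (Finset.Ici m).card ≤ (Finset.Ioi m).card :=
      Finset.card_le_card_of_injOn σ (fun j hj => by simpa using hcon j (by simpa using hj))
        σ.injective.injOn
    have hlt : (Finset.Ioi m).card < (Finset.Ici m).card :=
      Finset.card_lt_card <| Finset.ssubset_iff_of_subset Finset.Ioi_subset_Ici_self |>.2
        ⟨m, by simp, by simp⟩
    omega
  have hprod : ∏ i, M (σ i) i = 0 := Finset.prod_eq_zero (Finset.mem_univ j) (h _ _ hσ hj)
  rw [hprod, smul_zero]

/-- Elements of `K` are the images of invertible power series matrices. -/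
lemma exists_powerSeries_matrix {n : ℕ} {g : GLn n} (hg : g ∈ KSub n) :
    ∃ P : Matrix (Fin n) (Fin n) (PowerSeries ℂ),
      (∀ i j, HahnSeries.ofPowerSeries ℤ ℂ (P i j) = (g : Matrix (Fin n) (Fin n) Kfld) i j) ∧
        IsUnit P.det := by
  choose P hP using hg.1
  choose Q hQ using hg.2
  have hinj : Function.Injective ((HahnSeries.ofPowerSeries ℤ ℂ).mapMatrix (m := Fin n)) :=
    Matrix.map_injective HahnSeries.ofPowerSeries_injective
  have hP' : (HahnSeries.ofPowerSeries ℤ ℂ).mapMatrix (Matrix.of P) = g.val :=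
    Matrix.ext hP
  have hQ' : (HahnSeries.ofPowerSeries ℤ ℂ).mapMatrix (Matrix.of Q) = (g⁻¹).val :=
    Matrix.ext hQ
  refine ⟨Matrix.of P, hP, Matrix.isUnit_det_of_right_inverse (B := Matrix.of Q) (hinj ?_)⟩
  rw [map_mul, hP', hQ', map_one, Units.mul_inv]

lemma constantCoeff_eq_zero_of_mul_zpow_eq {p q : PowerSeries ℂ} {a b : ℤ} (hab : a < b)
    (h : HahnSeries.ofPowerSeries ℤ ℂ p * tK ^ a = tK ^ b * HahnSeries.ofPowerSeries ℤ ℂ q) :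
    PowerSeries.constantCoeff p = 0 := by
  obtain ⟨d, hd⟩ := Int.eq_ofNat_of_zero_le (sub_nonneg.2 (Int.add_one_le_of_lt hab))
  obtain rfl : b = (d + 1 : ℕ) + a := by push_cast; omega
  have hX : HahnSeries.ofPowerSeries ℤ ℂ PowerSeries.X = tK := HahnSeries.ofPowerSeries_X
  rw [zpow_add₀ tK_ne_zero, mul_right_comm, zpow_natCast] at h
  have hp := mul_right_cancel₀ (zpow_ne_zero a tK_ne_zero) h
  rw [← hX, ← map_pow, ← map_mul] at hp
  rw [HahnSeries.ofPowerSeries_injective hp, map_mul, map_pow]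
  simp

lemma le_of_mul_tPow_eq {n : ℕ} {lam mu : Fin n → ℤ} (hlam : Dominant lam) (hmu : Dominant mu)
    {a b : GLn n} (ha : a ∈ KSub n) (hb : b ∈ KSub n)
    (h : a * tPow n lam = tPow n mu * b) : mu ≤ lam := by
  intro m
  by_contra! hm
  obtain ⟨P, hP, hPu⟩ := exists_powerSeries_matrix ha
  obtain ⟨Q, hQ, -⟩ := exists_powerSeries_matrix hb
  have hdet : (PowerSeries.constantCoeff.mapMatrix P).det = 0 := by
    refine det_eq_zero_of_corner_eq_zero _ m fun i j hi hj => ?_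
    refine constantCoeff_eq_zero_of_mul_zpow_eq (q := Q i j)
      (((hlam m j hj).trans_lt hm).trans_le (hmu i m hi)) ?_
    have hij := congrArg (fun x : GLn n => (x : Matrix (Fin n) (Fin n) Kfld) i j) h
    simpa [tPow, Matrix.mul_diagonal, Matrix.diagonal_mul, hP, hQ] using hij
  rw [← RingHom.map_det] at hdet
  have hu := hPu.map (PowerSeries.constantCoeff (R := ℂ))
  exact not_isUnit_zero (hdet ▸ hu)

theorem statement2 (n : ℕ) (lam mu : Fin n → ℤ) (hlam : Dominant lam) (hmu : Dominant mu)
    (h : (dcoset n lam ∩ dcoset n mu).Nonempty) : lam = mu := by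
  obtain ⟨g, ⟨k₁, hk₁, k₂, hk₂, hg⟩, l₁, hl₁, l₂, hl₂, hg'⟩ := h
  have key : k₁ * tPow n lam * k₂ = l₁ * tPow n mu * l₂ := hg.symm.trans hg'
  refine le_antisymm
    (le_of_mul_tPow_eq hmu hlam (mul_mem (inv_mem hk₁) hl₁) (mul_mem hk₂ (inv_mem hl₂)) ?_)
    (le_of_mul_tPow_eq hlam hmu (mul_mem (inv_mem hl₁) hk₁) (mul_mem hl₂ (inv_mem hk₂)) ?_)
  · calc k₁⁻¹ * l₁ * tPow n mu = k₁⁻¹ * (l₁ * tPow n mu * l₂) * l₂⁻¹ := by group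
      _ = tPow n lam * (k₂ * l₂⁻¹) := by rw [← key]; group
  · calc l₁⁻¹ * k₁ * tPow n lam = l₁⁻¹ * (k₁ * tPow n lam * k₂) * k₂⁻¹ := by group
      _ = tPow n mu * (l₂ * k₂⁻¹) := by rw [key]; group

end
end

section
/- (Commutativity isomorphism for convolution fibres.) Let λ, μ ∈ ℤⁿ be dominant and let ν ∈ ℤⁿ. Define m_{λμ}⁻¹(t^ν) := { L ∈ Gr : d([1], L) = λ and d(L, [t^ν]) = μ }, and similarly m_{μλ}⁻¹(t^ν) := { L ∈ Gr : d([1], L) = μ and d(L, [t^ν]) = λ }. Then the map L ↦ t^ν · ψ(L) (where ψ acts on Gr by [g] ↦ [(gᵀ)⁻¹] and t^ν acts by left multiplication) maps m_{λμ}⁻¹(t^ν) into m_{μλ}⁻¹(t^ν) and is a bijection between these two sets; moreover this map is self-inverse, i.e. applying L ↦ t^ν · ψ(L) twice gives the identity on Gr. -/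
open scoped Pointwise

set_option synthInstance.maxHeartbeats 1000000
set_option maxHeartbeats 1000000

noncomputable section

def transGL {n : ℕ} (g : GLn n) : GLn n where
  val := (g : Matrix (Fin n) (Fin n) Kfld).transpose
  inv := ((g⁻¹ : GLn n) : Matrix (Fin n) (Fin n) Kfld).transpose
  val_inv := by
    rw [← Matrix.transpose_mul, Units.inv_mul, Matrix.transpose_one]
  inv_val := by
    rw [← Matrix.transpose_mul, Units.mul_inv, Matrix.transpose_one]

/-- `ψ(g) = (gᵀ)⁻¹`, the inverse-transpose map, as a map `GLn → GLn`. -/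
def psiGL {n : ℕ} (g : GLn n) : GLn n := (transGL g)⁻¹

lemma transGL_mul {n : ℕ} (a b : GLn n) : transGL (a * b) = transGL b * transGL a :=
  Units.ext (Matrix.transpose_mul (a : Matrix (Fin n) (Fin n) Kfld)
    (b : Matrix (Fin n) (Fin n) Kfld))

lemma transGL_inv {n : ℕ} (a : GLn n) : transGL a⁻¹ = (transGL a)⁻¹ :=
  Units.ext (by simp [transGL])

lemma transGL_mem {n : ℕ} {g : GLn n} (hg : g ∈ KSub n) : transGL g ∈ KSub n := by
  rw [mem_KSub] at hg ⊢
  refine ⟨fun i j => hg.1 j i, fun i j => ?_⟩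
  have h : ((transGL g)⁻¹ : GLn n) = transGL g⁻¹ := (transGL_inv g).symm
  rw [h]
  exact hg.2 j i

lemma psiGL_mem {n : ℕ} {g : GLn n} (hg : g ∈ KSub n) : psiGL g ∈ KSub n :=
  (KSub n).inv_mem (transGL_mem hg)

/-- The involution of the affine Grassmannian induced by `ψ`, `[g] ↦ [ψ(g)]`. -/
def PsiGr (n : ℕ) : Gr n → Gr n :=
  Quotient.map' psiGL (by
    intro a b hab
    rw [QuotientGroup.leftRel_apply] at hab ⊢
    have key : (psiGL a)⁻¹ * psiGL b = transGL (b⁻¹ * a) := by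
      rw [psiGL, psiGL, inv_inv, ← transGL_inv, ← transGL_mul]
    rw [key, show b⁻¹ * a = (a⁻¹ * b)⁻¹ by rw [mul_inv_rev, inv_inv]]
    exact transGL_mem ((KSub n).inv_mem hab))

lemma PsiGr_mk {n : ℕ} (g : GLn n) :
    PsiGr n (QuotientGroup.mk g) = QuotientGroup.mk (psiGL g) := rfl

lemma transGL_tPow (n : ℕ) (nu : Fin n → ℤ) : transGL (tPow n nu) = tPow n nu :=
  Units.ext (Matrix.diagonal_transpose _)

lemma transGL_transGL {n : ℕ} (g : GLn n) : transGL (transGL g) = g :=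
  Units.ext (Matrix.transpose_transpose _)

lemma transGL_mem_dcoset {n : ℕ} {lam : Fin n → ℤ} {g : GLn n} (hg : g ∈ dcoset n lam) :
    transGL g ∈ dcoset n lam := by
  obtain ⟨k₁, h₁, k₂, h₂, rfl⟩ := hg
  exact ⟨transGL k₂, transGL_mem h₂, transGL k₁, transGL_mem h₁, by
    rw [transGL_mul, transGL_mul, transGL_tPow, mul_assoc]⟩

lemma tK_zpow (a : ℤ) : tK ^ a = HahnSeries.single a 1 :=
  (RatFunc.single_zpow a).symm

/-- A square matrix with a zero block of size `(n - p) × (p + 1)` is singular. -/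
lemma det_eq_zero_of_zero_block {n : ℕ} {R : Type*} [CommRing R] (M : Matrix (Fin n) (Fin n) R)
    (p : Fin n) (h : ∀ i j, p ≤ i → j ≤ p → M i j = 0) : M.det = 0 := by
  rw [Matrix.det_apply]
  refine Finset.sum_eq_zero fun σ _ => ?_
  obtain ⟨j, hj, hpj⟩ : ∃ j, j ≤ p ∧ p ≤ σ j := by
    by_contra! hc
    have hcard : (Finset.Iic p).card ≤ (Finset.Iio p).card :=
      Finset.card_le_card_of_injOn σ (fun j hj => by simpa using hc j (by simpa using hj))
        σ.injective.injOn
    simp at hcard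
  have hprod : ∏ i, M (σ i) i = 0 := Finset.prod_eq_zero (Finset.mem_univ j) (h _ _ hpj hj)
  rw [hprod, smul_zero]

/-- The matrix of constant coefficients of an element of `GL_n(ℂ[[t]])` is invertible. -/
lemma det_coeff_zero_ne_zero {n : ℕ} {k : GLn n} (hk : k ∈ KSub n) :
    (Matrix.of fun i j => ((k : Matrix (Fin n) (Fin n) Kfld) i j).coeff 0).det ≠ 0 := by
  choose M hM using hk.1
  choose N hN using hk.2
  have hMN : (Matrix.of M) * (Matrix.of N) = 1 := by
    apply Matrix.map_injective (HahnSeries.ofPowerSeries_injective (Γ := ℤ) (R := ℂ))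
    have e₁ : (Matrix.of M).map (HahnSeries.ofPowerSeries ℤ ℂ) = k := by
      ext1 i j; exact hM i j
    have e₂ : (Matrix.of N).map (HahnSeries.ofPowerSeries ℤ ℂ) = (k⁻¹ : GLn n) := by
      ext1 i j; exact hN i j
    beta_reduce
    rw [Matrix.map_mul, e₁, e₂, Units.mul_inv, Matrix.map_one _ (map_zero _) (map_one _)]
  have hcoeff : (Matrix.of fun i j => ((k : Matrix (Fin n) (Fin n) Kfld) i j).coeff 0) =
      (Matrix.of M).map (PowerSeries.constantCoeff (R := ℂ)) := by
    ext i j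
    have h := HahnSeries.ofPowerSeries_apply_coeff (Γ := ℤ) (M i j) 0
    rw [hM] at h
    simpa using h
  have hdet := congrArg (fun A => (A.map (PowerSeries.constantCoeff (R := ℂ))).det) hMN
  simp only [Matrix.map_mul, Matrix.det_mul,
    Matrix.map_one _ (map_zero (PowerSeries.constantCoeff (R := ℂ))) (map_one _),
    Matrix.det_one] at hdet
  rw [hcoeff]
  exact left_ne_zero_of_mul_eq_one hdet

lemma coeff_zero_eq_zero_of_zpow_mul_mem {x : Kfld} {a : ℤ} (ha : a < 0)
    (hx : tK ^ a * x ∈ Oring) : x.coeff 0 = 0 := by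
  obtain ⟨q, hq⟩ := hx
  have h := congrArg (fun y : Kfld => y.coeff a) hq
  have h' : (HahnSeries.single a (1 : ℂ) * x).coeff (0 + a) = 1 * x.coeff 0 :=
    HahnSeries.coeff_single_mul_add
  simp only [tK_zpow] at h
  rw [zero_add, one_mul] at h'
  rw [← h', ← h, HahnSeries.ofPowerSeries_apply]
  refine HahnSeries.embDomain_of_notMem_range ?_
  rintro ⟨m, hm⟩
  have : (m : ℤ) = a := hm
  omega

lemma le_of_tPow_mem_dcoset {n : ℕ} {lam mu : Fin n → ℤ} (hlam : Dominant lam)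
    (hmu : Dominant mu) (h : tPow n lam ∈ dcoset n mu) (p : Fin n) : lam p ≤ mu p := by
  obtain ⟨k₁, h₁, k₂, h₂, h⟩ := h
  by_contra! hp
  refine det_coeff_zero_ne_zero h₂ (det_eq_zero_of_zero_block _ p fun i j hi hj => ?_)
  have hneg : mu i - lam j < 0 := by
    have := hmu p i hi
    have := hlam j p hj
    omega
  refine coeff_zero_eq_zero_of_zpow_mul_mem hneg ?_
  have heq : tPow n mu * k₂ = k₁⁻¹ * tPow n lam := by rw [h]; group
  have hij := congrArg (fun g : GLn n => (g : Matrix (Fin n) (Fin n) Kfld) i j) heq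
  simp only [Units.val_mul, tPow, Matrix.diagonal_mul, Matrix.mul_diagonal] at hij
  rw [sub_eq_add_neg, zpow_add₀ tK_ne_zero, mul_right_comm, hij, mul_assoc,
    ← zpow_add₀ tK_ne_zero, add_neg_cancel, zpow_zero, mul_one]
  exact h₁.2 i j

/-- Uniqueness in the Cartan decomposition. -/
lemma eq_of_mem_dcoset {n : ℕ} {lam mu : Fin n → ℤ} (hlam : Dominant lam) (hmu : Dominant mu)
    {g : GLn n} (hg : g ∈ dcoset n lam) (hg' : g ∈ dcoset n mu) : lam = mu := by
  have key : ∀ {a b : Fin n → ℤ}, g ∈ dcoset n a → g ∈ dcoset n b → tPow n a ∈ dcoset n b := by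
    rintro a b ⟨k₁, h₁, k₂, h₂, rfl⟩ ⟨l₁, m₁, l₂, m₂, h⟩
    refine ⟨k₁⁻¹ * l₁, mul_mem (inv_mem h₁) m₁, l₂ * k₂⁻¹, mul_mem m₂ (inv_mem h₂), ?_⟩
    calc tPow n a = k₁⁻¹ * (k₁ * tPow n a * k₂) * k₂⁻¹ := by group
      _ = _ := by rw [h]; group
  exact funext fun p => le_antisymm (le_of_tPow_mem_dcoset hlam hmu (key hg hg') p)
    (le_of_tPow_mem_dcoset hmu hlam (key hg' hg) p)

lemma tPow_smul_PsiGr_involutive {n : ℕ} (nu : Fin n → ℤ) :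
    Function.Involutive fun L : Gr n => tPow n nu • PsiGr n L := by
  intro L
  induction L using QuotientGroup.induction_on with
  | H g =>
    change (QuotientGroup.mk (tPow n nu * psiGL (tPow n nu * psiGL g)) : Gr n) = _
    congr 1
    rw [psiGL, psiGL, transGL_mul, transGL_inv, transGL_transGL, transGL_tPow, mul_inv_rev,
      inv_inv, mul_inv_cancel_left]

lemma mapsTo_tPow_smul_PsiGr {n : ℕ} {lam mu : Fin n → ℤ} (nu : Fin n → ℤ) (hlam : Dominant lam)
    (hmu : Dominant mu) (d : Gr n → Gr n → (Fin n → ℤ))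
    (hd : ∀ g₁ g₂ : GLn n, Dominant (d (QuotientGroup.mk g₁) (QuotientGroup.mk g₂)) ∧
      g₁⁻¹ * g₂ ∈ dcoset n (d (QuotientGroup.mk g₁) (QuotientGroup.mk g₂))) :
    Set.MapsTo (fun L : Gr n => tPow n nu • PsiGr n L)
      {L : Gr n | d (QuotientGroup.mk 1) L = lam ∧ d L (QuotientGroup.mk (tPow n nu)) = mu}
      {L : Gr n | d (QuotientGroup.mk 1) L = mu ∧ d L (QuotientGroup.mk (tPow n nu)) = lam} := by
  intro L
  induction L using QuotientGroup.induction_on with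
  | H g =>
    rintro ⟨h₁, h₂⟩
    have hg₁ := transGL_mem_dcoset (hd 1 g).2
    have hg₂ := transGL_mem_dcoset (hd g (tPow n nu)).2
    rw [h₁, inv_one, one_mul] at hg₁
    rw [h₂, transGL_mul, transGL_tPow, transGL_inv] at hg₂
    have e₁ := hd 1 (tPow n nu * psiGL g)
    have e₂ := hd (tPow n nu * psiGL g) (tPow n nu)
    refine ⟨eq_of_mem_dcoset e₁.1 hmu e₁.2 ?_, eq_of_mem_dcoset e₂.1 hlam e₂.2 ?_⟩
    · rwa [inv_one, one_mul]
    · rwa [mul_inv_rev, inv_mul_cancel_right, psiGL, inv_inv]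

theorem statement7 (n : ℕ) (lam mu nu : Fin n → ℤ) (hlam : Dominant lam) (hmu : Dominant mu)
    (d : Gr n → Gr n → (Fin n → ℤ))
    (hd : ∀ g₁ g₂ : GLn n, Dominant (d (QuotientGroup.mk g₁) (QuotientGroup.mk g₂)) ∧
      g₁⁻¹ * g₂ ∈ dcoset n (d (QuotientGroup.mk g₁) (QuotientGroup.mk g₂))) :
    (∀ L ∈ {L : Gr n | d (QuotientGroup.mk 1) L = lam ∧
        d L (QuotientGroup.mk (tPow n nu)) = mu},
      tPow n nu • PsiGr n L ∈ {L : Gr n | d (QuotientGroup.mk 1) L = mu ∧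
        d L (QuotientGroup.mk (tPow n nu)) = lam}) ∧
    Set.BijOn (fun L : Gr n => tPow n nu • PsiGr n L)
      {L : Gr n | d (QuotientGroup.mk 1) L = lam ∧ d L (QuotientGroup.mk (tPow n nu)) = mu}
      {L : Gr n | d (QuotientGroup.mk 1) L = mu ∧ d L (QuotientGroup.mk (tPow n nu)) = lam} ∧
    (∀ L : Gr n, tPow n nu • PsiGr n (tPow n nu • PsiGr n L) = L) := by
  have hinv := tPow_smul_PsiGr_involutive nu
  have hmap := mapsTo_tPow_smul_PsiGr nu hlam hmu d hd
  have hmap' := mapsTo_tPow_smul_PsiGr nu hmu hlam d hd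
  exact ⟨hmap, ⟨hmap, hinv.injective.injOn, fun L hL => ⟨_, hmap' hL, hinv L⟩⟩, hinv⟩

end
end

section
/- (Lattice model of the affine Grassmannian.) The map gK ↦ g·𝒪ⁿ (the image of the standard lattice 𝒪ⁿ ⊆ 𝒦ⁿ under the linear automorphism of 𝒦ⁿ given by g) is a well-defined bijection from Gr = GL_n(𝒦)/K onto the set of full 𝒪-lattices in 𝒦ⁿ, i.e. the set of finitely generated 𝒪-submodules L ⊆ 𝒦ⁿ whose 𝒦-span is all of 𝒦ⁿ. -/
open scoped Pointwise

set_option synthInstance.maxHeartbeats 1000000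
set_option maxHeartbeats 1000000

noncomputable section

/-- The standard lattice `𝒪ⁿ ⊆ 𝒦ⁿ`. -/
def stdLat (n : ℕ) : Submodule Oring (Fin n → Kfld) where
  carrier := {v | ∀ i, v i ∈ Oring}
  add_mem' := fun hu hv i => add_mem (hu i) (hv i)
  zero_mem' := fun i => zero_mem _
  smul_mem' := fun c v hv i => by
    have h : (c • v) i = (c : Kfld) * v i := rfl
    rw [h]
    exact mul_mem c.2 (hv i)

/-- The lattice `g · 𝒪ⁿ`. -/
def latOf {n : ℕ} (g : GLn n) : Submodule Oring (Fin n → Kfld) :=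
  Submodule.map
    ((Matrix.mulVecLin (g : Matrix (Fin n) (Fin n) Kfld)).restrictScalars Oring)
    (stdLat n)

lemma mem_latOf {n : ℕ} (g : GLn n) (v : Fin n → Kfld) :
    v ∈ latOf g ↔
      ∀ i, (((g⁻¹ : GLn n) : Matrix (Fin n) (Fin n) Kfld).mulVec v) i ∈ Oring := by
  constructor
  · rintro ⟨w, hw, rfl⟩ i
    have h : ((g⁻¹ : GLn n) : Matrix (Fin n) (Fin n) Kfld).mulVec
        ((g : Matrix (Fin n) (Fin n) Kfld).mulVec w) = w := by
      rw [Matrix.mulVec_mulVec, Units.inv_mul, Matrix.one_mulVec]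
    change Matrix.mulVec _ (Matrix.mulVec _ w) i ∈ Oring
    rw [h]
    exact hw i
  · intro hv
    refine ⟨_, hv, ?_⟩
    change (g : Matrix (Fin n) (Fin n) Kfld).mulVec (Matrix.mulVec _ v) = v
    rw [Matrix.mulVec_mulVec, Units.mul_inv, Matrix.one_mulVec]

lemma col_mem_latOf {n : ℕ} (g : GLn n) (j : Fin n) :
    (g : Matrix (Fin n) (Fin n) Kfld).col j ∈ latOf g := by
  refine ⟨Pi.single j 1, fun i => ?_, ?_⟩
  · rw [Pi.single_apply]
    split
    · exact one_mem _
    · exact zero_mem _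
  · exact Matrix.mulVec_single_one _ j

lemma latOf_eq_span_col {n : ℕ} (g : GLn n) :
    latOf g = Submodule.span Oring (Set.range (g : Matrix (Fin n) (Fin n) Kfld).col) := by
  apply le_antisymm
  · rintro _ ⟨w, hw, rfl⟩
    have h : (g : Matrix (Fin n) (Fin n) Kfld).mulVec w =
        ∑ j, (⟨w j, hw j⟩ : Oring) • (g : Matrix (Fin n) (Fin n) Kfld).col j := by
      rw [Matrix.mulVec_eq_sum]
      refine Finset.sum_congr rfl fun j _ => ?_
      ext1 i
      exact mul_comm _ _
    change (g : Matrix (Fin n) (Fin n) Kfld).mulVec w ∈ _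
    rw [h]
    exact Submodule.sum_mem _ fun j _ =>
      Submodule.smul_mem _ _ (Submodule.subset_span ⟨j, rfl⟩)
  · rw [Submodule.span_le]
    rintro _ ⟨j, rfl⟩
    exact col_mem_latOf g j

lemma latOf_le_latOf_iff {n : ℕ} (g h : GLn n) :
    latOf h ≤ latOf g ↔
      ∀ i j, ((g⁻¹ * h : GLn n) : Matrix (Fin n) (Fin n) Kfld) i j ∈ Oring := by
  rw [latOf_eq_span_col h, Submodule.span_le, Set.range_subset_iff, forall_comm]
  exact forall_congr' fun j => mem_latOf g _

lemma span_range_col_eq_top {n : Type*} [Fintype n] [DecidableEq n] {F : Type*} [Field F]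
    (g : Matrix.GeneralLinearGroup n F) :
    Submodule.span F (Set.range (g : Matrix n n F).col) = ⊤ := by
  rw [← Matrix.range_mulVecLin, LinearMap.range_eq_top]
  intro v
  refine ⟨((g⁻¹ : Matrix.GeneralLinearGroup n F) : Matrix n n F).mulVec v, ?_⟩
  rw [Matrix.mulVecLin_apply, Matrix.mulVec_mulVec, Units.mul_inv, Matrix.one_mulVec]

lemma exists_span_range_col_eq {n : Type*} [Fintype n] [DecidableEq n] {R F : Type*}
    [CommRing R] [IsDomain R] [IsPrincipalIdealRing R] [Field F] [Algebra R F]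
    [IsFractionRing R F] (L : Submodule R (n → F)) (hL : L.FG)
    (hspan : Submodule.span F (L : Set (n → F)) = ⊤) :
    ∃ g : Matrix.GeneralLinearGroup n F,
      Submodule.span R (Set.range (g : Matrix n n F).col) = L := by
  have : Submodule.IsLattice F L := ⟨hL, hspan⟩
  have : Module.Finite R L := Module.Finite.iff_fg.mpr hL
  let b := Module.Free.chooseBasis R L
  let e := (b.extendOfIsLattice F).indexEquiv (Pi.basisFun F n)
  let B := (b.reindex e).extendOfIsLattice F
  let g : Matrix.GeneralLinearGroup n F :=
    ⟨(Pi.basisFun F n).toMatrix B, B.toMatrix (Pi.basisFun F n),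
      Module.Basis.toMatrix_mul_toMatrix_flip _ _, Module.Basis.toMatrix_mul_toMatrix_flip _ _⟩
  refine ⟨g, ?_⟩
  have hcol : (g : Matrix n n F).col = L.subtype ∘ b.reindex e := by
    ext j i
    change B j i = _
    simp [B]
  rw [hcol, Set.range_comp, ← Submodule.map_span, Module.Basis.span_eq,
    Submodule.map_subtype_top]

lemma span_latOf {n : ℕ} (g : GLn n) :
    Submodule.span Kfld (latOf g : Set (Fin n → Kfld)) = ⊤ := by
  refine top_unique (le_trans (span_range_col_eq_top g).ge (Submodule.span_mono ?_))
  exact Set.range_subset_iff.mpr (col_mem_latOf g)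

instance isPrincipalIdealRing_Oring : IsPrincipalIdealRing Oring :=
  IsPrincipalIdealRing.of_surjective (HahnSeries.ofPowerSeries ℤ ℂ).rangeRestrict
    (HahnSeries.ofPowerSeries ℤ ℂ).rangeRestrict_surjective

instance isFractionRing_Oring : IsFractionRing Oring Kfld := by
  refine IsFractionRing.of_field _ _ fun z => ?_
  obtain ⟨x, y, _, h⟩ := IsFractionRing.div_surjective (A := PowerSeries ℂ) z
  exact ⟨⟨_, x, rfl⟩, ⟨_, y, rfl⟩, h.symm⟩

lemma exists_latOf_eq {n : ℕ} (L : Submodule Oring (Fin n → Kfld)) (hL : L.FG)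
    (hspan : Submodule.span Kfld (L : Set (Fin n → Kfld)) = ⊤) : ∃ g : GLn n, latOf g = L := by
  obtain ⟨g, hg⟩ := exists_span_range_col_eq L hL hspan
  exact ⟨g, (latOf_eq_span_col g).trans hg⟩

theorem statement8 (n : ℕ) :
    (∀ g h : GLn n, (QuotientGroup.mk g : Gr n) = QuotientGroup.mk h ↔ latOf g = latOf h) ∧
    (∀ g : GLn n, (latOf g).FG ∧
      Submodule.span Kfld ((latOf g : Submodule Oring (Fin n → Kfld)) : Set (Fin n → Kfld)) = ⊤) ∧
    (∀ L : Submodule Oring (Fin n → Kfld), L.FG →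
      Submodule.span Kfld (L : Set (Fin n → Kfld)) = ⊤ → ∃ g : GLn n, latOf g = L) := by
  refine ⟨fun g h => ?_, fun g => ⟨?_, span_latOf g⟩, exists_latOf_eq⟩
  · rw [QuotientGroup.eq, mem_KSub, mul_inv_rev, inv_inv, ← latOf_le_latOf_iff,
      ← latOf_le_latOf_iff, and_comm, le_antisymm_iff]
  · rw [latOf_eq_span_col]
    exact Submodule.fg_span (Set.finite_range _)

end
end
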